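/- Let ℓ ≤ n be positive integers and let G be a subgroup of S_ℓ. Then gPat_ℓ(gComp^n(G)) = Aut(pcExt G); that is, the Galois kernel of G under the monotone Galois connection (gPat_ℓ, gComp^n) equals the group of all permutations of [ℓ] preserving every pc-extended invariant of G. -/

import Mathlib

open Equiv Finset Function

/-- `h_I : [ℓ] → [n]`: the increasing enumeration of an `ℓ`-element subset `I ⊆ [n]`,
i.e., the unique order isomorphism `([ℓ], ≤) → (I, ≤)` viewed as a map into `[n]`. -/
def hmap {ℓ n : ℕ} (I : Finset (Fin n)) (hI : I.card = ℓ) : Fin ℓ → Fin n :=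
  fun i => ((I.orderIsoOfFin hI) i : Fin n)

theorem hmap_injective {ℓ n : ℕ} (I : Finset (Fin n)) (hI : I.card = ℓ) :
    Function.Injective (hmap I hI) := fun a b h =>
  (I.orderIsoOfFin hI).injective (Subtype.ext h)

theorem mem_image_iff_perm {n : ℕ} (π : Equiv.Perm (Fin n)) (I : Finset (Fin n)) (a : Fin n) :
    a ∈ I ↔ π a ∈ I.image ⇑π := by
  constructor
  · exact fun h => Finset.mem_image_of_mem _ h
  · intro h
    obtain ⟨b, hb, hba⟩ := Finset.mem_image.mp h
    rwa [← π.injective hba]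

/-- The pattern `π_I := h_{π(I)}⁻¹ ∘ π ∘ h_I ∈ S_ℓ` of `π ∈ S_n` at an `ℓ`-element
subset `I ⊆ [n]`. -/
def patt {ℓ n : ℕ} (π : Equiv.Perm (Fin n)) (I : Finset (Fin n)) (hI : I.card = ℓ) :
    Equiv.Perm (Fin ℓ) :=
  (I.orderIsoOfFin hI).toEquiv.trans
    ((π.subtypeEquiv (mem_image_iff_perm π I)).trans
      ((I.image ⇑π).orderIsoOfFin
        (by rw [Finset.card_image_of_injective _ π.injective, hI])).toEquiv.symm)

/-- `Pat_ℓ(π)`: the set of `ℓ`-patterns of `π ∈ S_n`. -/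
def PattSet (ℓ : ℕ) {n : ℕ} (π : Equiv.Perm (Fin n)) : Set (Equiv.Perm (Fin ℓ)) :=
  {σ | ∃ (I : Finset (Fin n)) (hI : I.card = ℓ), σ = patt π I hI}

/-- `Comp^n(S)`: the set of `n`-permutations all of whose `ℓ`-patterns lie in `S`. -/
def CompSet (n : ℕ) {ℓ : ℕ} (S : Set (Equiv.Perm (Fin ℓ))) : Set (Equiv.Perm (Fin n)) :=
  {τ | PattSet ℓ τ ⊆ S}

/-- Pattern involvement: `σ ≤ π` iff `σ = π_I` for some `ℓ`-element subset `I`. -/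
def Involves {ℓ n : ℕ} (σ : Equiv.Perm (Fin ℓ)) (π : Equiv.Perm (Fin n)) : Prop :=
  σ ∈ PattSet ℓ π

/-- `gPat_ℓ(H)`: the subgroup of `S_ℓ` generated by the `ℓ`-patterns of members of `H`. -/
def gPat (ℓ : ℕ) {n : ℕ} (H : Set (Equiv.Perm (Fin n))) : Subgroup (Equiv.Perm (Fin ℓ)) :=
  Subgroup.closure (⋃ τ ∈ H, PattSet ℓ τ)

/-- A function preserves a `k`-ary relation (componentwise application keeps tuples in
the relation). -/
def Preserves {α : Type*} {k : ℕ} (f : α → α) (ρ : Set (Fin k → α)) : Prop :=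
  ∀ r ∈ ρ, (f ∘ r) ∈ ρ

/-- The `ℓ`-orbit `a^H = {σ ∘ a : σ ∈ H}`. -/
def orbitRel {ℓ n : ℕ} (H : Subgroup (Equiv.Perm (Fin n))) (a : Fin ℓ → Fin n) :
    Set (Fin ℓ → Fin n) :=
  {x | ∃ σ ∈ H, x = ⇑σ ∘ a}

/-- The reduction `red(u) = h_{range u}⁻¹ ∘ u` of a tuple with pairwise distinct
entries. -/
def red {k n : ℕ} (u : Fin k → Fin n) (hu : Function.Injective u) : Fin k → Fin k :=
  fun i =>
    ((Finset.univ.image u).orderIsoOfFin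
      (by rw [Finset.card_image_of_injective _ hu]; simp)).symm
      ⟨u i, Finset.mem_image_of_mem _ (Finset.mem_univ i)⟩

/-- `red(ρ) = {red(r) : r ∈ ρ}` for a set `ρ` of tuples with pairwise distinct entries. -/
def redSet {k n : ℕ} (ρ : Set (Fin k → Fin n)) : Set (Fin k → Fin k) :=
  {v | ∃ (r : Fin k → Fin n) (_ : r ∈ ρ) (hr : Function.Injective r), v = red r hr}

/-- `ρ̌ := {h_I⁻¹ ∘ r : r ∈ ρ, range r ⊆ I, I an ℓ-element subset of [n]}`. -/
def checkRel (ℓ : ℕ) {k n : ℕ} (ρ : Set (Fin k → Fin n)) : Set (Fin k → Fin ℓ) :=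
  {s | ∃ (r : Fin k → Fin n) (_ : r ∈ ρ) (I : Finset (Fin n)) (hI : I.card = ℓ)
        (hr : ∀ j, r j ∈ I), s = fun j => (I.orderIsoOfFin hI).symm ⟨r j, hr j⟩}

/-- `σ̂ := {h_J ∘ s : s ∈ σ, J an ℓ-element subset of [n]}`. -/
def hatRel (n : ℕ) {k ℓ : ℕ} (σ : Set (Fin k → Fin ℓ)) : Set (Fin k → Fin n) :=
  {r | ∃ (s : Fin k → Fin ℓ) (_ : s ∈ σ) (J : Finset (Fin n)) (hJ : J.card = ℓ),
        r = hmap J hJ ∘ s}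

/-- `ρ` is a pattern closed relation (pc-relation): for every `r ∈ ρ` and all
`ℓ`-element subsets `I, J ⊆ [n]` with `range r ⊆ I`, the tuple `h_J ∘ h_I⁻¹ ∘ r`
belongs to `ρ`. -/
def IsPC (ℓ : ℕ) {k n : ℕ} (ρ : Set (Fin k → Fin n)) : Prop :=
  ∀ r ∈ ρ, ∀ (I J : Finset (Fin n)) (hI : I.card = ℓ) (hJ : J.card = ℓ)
    (hr : ∀ j, r j ∈ I),
    (fun j => hmap J hJ ((I.orderIsoOfFin hI).symm ⟨r j, hr j⟩)) ∈ ρ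
theorem apply_hmap {ℓ n : ℕ} (π : Equiv.Perm (Fin n)) (I : Finset (Fin n)) (hI : I.card = ℓ)
    (hI' : (I.image ⇑π).card = ℓ) (i : Fin ℓ) :
    π (hmap I hI i) = hmap (I.image ⇑π) hI' (patt π I hI i) := by
  simp [hmap, patt]

theorem comp_hmap_comp {k ℓ n : ℕ} (π : Equiv.Perm (Fin n)) (I : Finset (Fin n))
    (hI : I.card = ℓ) (hI' : (I.image ⇑π).card = ℓ) (s : Fin k → Fin ℓ) :
    ⇑π ∘ (hmap I hI ∘ s) = hmap (I.image ⇑π) hI' ∘ (patt π I hI ∘ s) :=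
  funext fun j => apply_hmap π I hI hI' (s j)

theorem card_image_perm {ℓ n : ℕ} (π : Equiv.Perm (Fin n)) {I : Finset (Fin n)}
    (hI : I.card = ℓ) : (I.image ⇑π).card = ℓ := by
  rw [Finset.card_image_of_injective _ π.injective, hI]

theorem hmap_mem {ℓ n : ℕ} (I : Finset (Fin n)) (hI : I.card = ℓ) (i : Fin ℓ) :
    hmap I hI i ∈ I :=
  ((I.orderIsoOfFin hI) i).2

theorem hmap_orderIsoOfFin_symm {ℓ n : ℕ} (I : Finset (Fin n)) (hI : I.card = ℓ)
    (x : Fin n) (hx : x ∈ I) : hmap I hI ((I.orderIsoOfFin hI).symm ⟨x, hx⟩) = x := by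
  simp [hmap]

theorem image_hmap {ℓ n : ℕ} (I : Finset (Fin n)) (hI : I.card = ℓ) :
    Finset.univ.image (hmap I hI) = I := by
  ext x
  simp only [Finset.mem_image, Finset.mem_univ, true_and]
  exact ⟨fun ⟨i, hi⟩ => hi ▸ hmap_mem I hI i,
    fun hx => ⟨_, hmap_orderIsoOfFin_symm I hI x hx⟩⟩

/-- An `ℓ`-element set is recovered from any arrangement of its elements. -/
theorem hmap_comp_perm_inj {ℓ n : ℕ} {I J : Finset (Fin n)} {hI : I.card = ℓ}
    {hJ : J.card = ℓ} {f g : Equiv.Perm (Fin ℓ)} (h : hmap I hI ∘ f = hmap J hJ ∘ g) :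
    f = g := by
  have hIJ : I = J := by
    rw [← image_hmap I hI, ← image_hmap J hJ]
    have h' := congrArg (fun u => Finset.univ.image u) h
    simpa [← Finset.image_image, Finset.image_univ_equiv] using h'
  subst hIJ
  exact Equiv.ext fun i => hmap_injective I hI (congrFun h i)

theorem mem_checkRel_of_hmap_comp_mem {k ℓ n : ℕ} {ρ : Set (Fin k → Fin n)}
    {s : Fin k → Fin ℓ} (I : Finset (Fin n)) (hI : I.card = ℓ) (h : hmap I hI ∘ s ∈ ρ) :
    s ∈ checkRel ℓ ρ := by
  refine ⟨_, h, I, hI, fun j => hmap_mem I hI (s j), ?_⟩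
  funext j
  exact ((I.orderIsoOfFin hI).symm_apply_apply (s j)).symm

theorem exists_hmap_comp_mem_of_mem_checkRel {k ℓ n : ℕ} {ρ : Set (Fin k → Fin n)}
    {s : Fin k → Fin ℓ} (h : s ∈ checkRel ℓ ρ) :
    ∃ (I : Finset (Fin n)) (hI : I.card = ℓ), hmap I hI ∘ s ∈ ρ := by
  obtain ⟨r, hr, I, hI, hrI, rfl⟩ := h
  refine ⟨I, hI, ?_⟩
  convert hr using 1
  exact funext fun j => hmap_orderIsoOfFin_symm I hI (r j) (hrI j)

theorem exists_card_eq_of_le {ℓ n : ℕ} (hn : ℓ ≤ n) :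
    ∃ I : Finset (Fin n), I.card = ℓ := by
  obtain ⟨I, -, hI⟩ := Finset.exists_subset_card_eq (s := (Finset.univ : Finset (Fin n)))
    (n := ℓ) (by simpa using hn)
  exact ⟨I, hI⟩

theorem checkRel_hatRel_subgroup {ℓ n : ℕ} (hn : ℓ ≤ n) (K : Subgroup (Equiv.Perm (Fin ℓ))) :
    checkRel ℓ (hatRel n {s : Fin ℓ → Fin ℓ | ∃ g ∈ K, s = ⇑g}) =
      {s : Fin ℓ → Fin ℓ | ∃ g ∈ K, s = ⇑g} := by
  ext s
  constructor
  · intro hs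
    obtain ⟨I, hI, _, ⟨g, hg, rfl⟩, J, hJ, h⟩ := exists_hmap_comp_mem_of_mem_checkRel hs
    have hinj : Function.Injective s :=
      Function.Injective.of_comp (f := hmap I hI)
        (h ▸ (hmap_injective J hJ).comp g.injective)
    let f : Equiv.Perm (Fin ℓ) := Equiv.ofBijective s (Finite.injective_iff_bijective.mp hinj)
    exact ⟨g, hg, congrArg DFunLike.coe (hmap_comp_perm_inj (f := f) h)⟩
  · intro hs
    obtain ⟨I, hI⟩ := exists_card_eq_of_le hn
    exact mem_checkRel_of_hmap_comp_mem I hI ⟨s, hs, I, hI, rfl⟩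

/-- A permutation all of whose patterns lie in `K` preserves the extension of `K`, and
conversely. -/
theorem preserves_hatRel_subgroup_iff {ℓ n : ℕ} (K : Subgroup (Equiv.Perm (Fin ℓ)))
    (π : Equiv.Perm (Fin n)) :
    Preserves ⇑π (hatRel n {s : Fin ℓ → Fin ℓ | ∃ g ∈ K, s = ⇑g}) ↔
      π ∈ CompSet n (K : Set (Equiv.Perm (Fin ℓ))) := by
  constructor
  · rintro h _ ⟨I, hI, rfl⟩
    obtain ⟨_, ⟨g, hg, rfl⟩, J, hJ, hJg⟩ :=
      h (hmap I hI ∘ ⇑(1 : Equiv.Perm (Fin ℓ))) ⟨_, ⟨1, K.one_mem, rfl⟩, I, hI, rfl⟩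
    rw [comp_hmap_comp π I hI (card_image_perm π hI)] at hJg
    rw [hmap_comp_perm_inj (f := patt π I hI) hJg]
    exact hg
  · rintro h _ ⟨_, ⟨g, hg, rfl⟩, J, hJ, rfl⟩
    exact ⟨_, ⟨patt π J hJ * g, K.mul_mem (h ⟨J, hJ, rfl⟩) hg, rfl⟩, J.image ⇑π,
      card_image_perm π hJ, comp_hmap_comp π J hJ _ _⟩

/-- A pattern of a permutation preserving `σ̂` preserves `σ`, provided `(σ̂)̌ = σ`. -/
theorem preserves_patt {k ℓ n : ℕ} {σ : Set (Fin k → Fin ℓ)}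
    (hσ : checkRel ℓ (hatRel n σ) = σ) {π : Equiv.Perm (Fin n)}
    (hπ : Preserves ⇑π (hatRel n σ)) (I : Finset (Fin n)) (hI : I.card = ℓ) :
    Preserves ⇑(patt π I hI) σ := by
  intro s hs
  rw [← hσ]
  refine mem_checkRel_of_hmap_comp_mem (I.image ⇑π) (card_image_perm π hI) ?_
  rw [← comp_hmap_comp]
  exact hπ _ ⟨s, hs, I, hI, rfl⟩

theorem preserves_of_mem_closure {α : Type*} [Finite α] {k : ℕ} {σ : Set (Fin k → α)}
    {S : Set (Equiv.Perm α)} (hS : ∀ g ∈ S, Preserves ⇑g σ) {g : Equiv.Perm α}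
    (hg : g ∈ Subgroup.closure S) : Preserves ⇑g σ := by
  rw [← Subgroup.mem_toSubmonoid, Subgroup.closure_toSubmonoid_of_finite] at hg
  induction hg using Submonoid.closure_induction with
  | mem x hx => exact hS x hx
  | one => exact fun r hr => hr
  | mul x y _ _ hx hy => exact fun r hr => hx _ (hy r hr)

/-- Theorem 5.10: `gPat_ℓ(gComp^n(G)) = Aut (pcExt G)`: the Galois kernel of `G ≤ S_ℓ`
equals the group of all permutations of `[ℓ]` preserving every pc-extended invariant of
`G`, i.e., every relation `σ ⊆ [ℓ]^k` (`k ≤ ℓ`) with `(σ̂)̌ = σ` such that `σ̂` is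
preserved by every permutation preserving `(G♮)̂`. -/
theorem stmt19 (ℓ n : ℕ) (hℓ : 0 < ℓ) (hn : ℓ ≤ n) (G : Subgroup (Equiv.Perm (Fin ℓ))) :
    ((gPat ℓ (CompSet n (G : Set (Equiv.Perm (Fin ℓ))))) :
        Set (Equiv.Perm (Fin ℓ))) =
      {g : Equiv.Perm (Fin ℓ) | ∀ (k : ℕ), 0 < k → k ≤ ℓ →
        ∀ σ : Set (Fin k → Fin ℓ), checkRel ℓ (hatRel n σ) = σ →
          (∀ π : Equiv.Perm (Fin n),
            Preserves ⇑π (hatRel n {s : Fin ℓ → Fin ℓ | ∃ g' ∈ G, s = ⇑g'}) →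
              Preserves ⇑π (hatRel n σ)) →
          Preserves ⇑g σ} := by
  apply Set.Subset.antisymm
  · intro g hg k _ _ σ hσ hext
    refine preserves_of_mem_closure ?_ hg
    intro x hx
    obtain ⟨π, hπ, I, hI, rfl⟩ := Set.mem_iUnion₂.mp hx
    exact preserves_patt hσ (hext π ((preserves_hatRel_subgroup_iff G π).mpr hπ)) I hI
  · intro g hg
    set K := gPat ℓ (CompSet n (G : Set (Equiv.Perm (Fin ℓ))))
    have hcomp : CompSet n (G : Set (Equiv.Perm (Fin ℓ))) ⊆
        CompSet n (K : Set (Equiv.Perm (Fin ℓ))) := fun π hπ x hx =>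
      Subgroup.subset_closure (Set.mem_iUnion₂.mpr ⟨π, hπ, hx⟩)
    obtain ⟨g', hg', h⟩ := hg ℓ hℓ le_rfl _ (checkRel_hatRel_subgroup hn K)
      (fun π hπ => (preserves_hatRel_subgroup_iff K π).mpr
        (hcomp ((preserves_hatRel_subgroup_iff G π).mp hπ)))
      ⇑(1 : Equiv.Perm (Fin ℓ)) ⟨1, K.one_mem, rfl⟩
    have : g = g' := DFunLike.coe_injective h
    exact this ▸ hg'
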